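/- Let p ≥ 1 be an integer and let Γ ∈ ℂ[x,y,z] be a nonzero homogeneous polynomial of degree at most 36p − 5 that vanishes to order at least 12p − 2 at each of the six points (1:1:0), (1:−1:0), (1:0:1), (1:0:−1), (0:1:1), (0:1:−1) of ℙ², to order at least 18p at each of the three coordinate points (1:0:0), (0:1:0), (0:0:1), and to order at least 3p + 1 at each of the four points (1:1:1), (−1:−1:1), (1:−1:1), (−1:1:1). Then each of x^{8p+1}, y^{8p+1}, and z^{8p+1} divides Γ. -/

import Mathlib

open MvPolynomial

/-- A polynomial `F ∈ ℂ[x,y,z]` vanishes to order at least `m` at a point of `ℙ²` with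
representative vector `v` if all partial derivatives of `F` of total order less than `m`
vanish at `v`. -/
def vanishesToOrder2 (F : MvPolynomial (Fin 3) ℂ) (v : Fin 3 → ℂ) (m : ℕ) : Prop :=
  ∀ l : List (Fin 3), l.length < m →
    eval v (l.foldl (fun G i => pderiv i G) F) = 0

/-- The six points `(1:1:0), (1:−1:0), (1:0:1), (1:0:−1), (0:1:1), (0:1:−1)` of `ℙ²`. -/
def starPts : Fin 6 → (Fin 3 → ℂ) :=
  ![![1, 1, 0], ![1, -1, 0], ![1, 0, 1], ![1, 0, -1], ![0, 1, 1], ![0, 1, -1]]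

/-- The three coordinate points of `ℙ²`. -/
def coordPts : Fin 3 → (Fin 3 → ℂ) :=
  ![![1, 0, 0], ![0, 1, 0], ![0, 0, 1]]

/-- The four points `(1:1:1), (−1:−1:1), (1:−1:1), (−1:1:1)` of `ℙ²`. -/
def zPts : Fin 4 → (Fin 3 → ℂ) :=
  ![![1, 1, 1], ![-1, -1, 1], ![1, -1, 1], ![-1, 1, 1]]

lemma vanish_pderiv {F : MvPolynomial (Fin 3) ℂ} {v : Fin 3 → ℂ} {m : ℕ}
    (h : vanishesToOrder2 F v (m + 1)) (i : Fin 3) : vanishesToOrder2 (pderiv i F) v m := by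
  intro l hl
  have := h (i :: l) (by simpa using hl)
  simpa using this

lemma vanish_iter (i : Fin 3) (v : Fin 3 → ℂ) (a : ℕ) :
    ∀ (F : MvPolynomial (Fin 3) ℂ) (m : ℕ), vanishesToOrder2 F v m →
      vanishesToOrder2 ((pderiv i)^[a] F) v (m - a) := by
  induction a with
  | zero => intro F m h; simpa using h
  | succ a ih =>
    intro F m h
    rcases m with _ | m
    · intro l hl; simp at hl
    · have := ih _ _ (vanish_pderiv h i)
      rw [Function.iterate_succ_apply]
      simpa using this

lemma homog_iter (i : Fin 3) (a : ℕ) :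
    ∀ (F : MvPolynomial (Fin 3) ℂ) (d : ℕ), F.IsHomogeneous d →
      ((pderiv i)^[a] F).IsHomogeneous (d - a) := by
  induction a with
  | zero => intro F m h; simpa using h
  | succ a ih =>
    intro F d h
    rw [Function.iterate_succ_apply]
    have := ih _ _ (h.pderiv (i := i))
    rwa [Nat.sub_sub, Nat.add_comm 1 a] at this

lemma derivative_aeval (ℓ : Fin 3 → Polynomial ℂ) (F : MvPolynomial (Fin 3) ℂ) :
    Polynomial.derivative (aeval ℓ F) =
      ∑ i, aeval ℓ (pderiv i F) * Polynomial.derivative (ℓ i) := by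
  induction F using MvPolynomial.induction_on with
  | C a => simp
  | add p q hp hq => simp [hp, hq, add_mul, Finset.sum_add_distrib]
  | mul_X p n hp =>
    have hX : ∑ i, aeval ℓ (pderiv i (X n : MvPolynomial (Fin 3) ℂ)) *
        Polynomial.derivative (ℓ i) = Polynomial.derivative (ℓ n) := by
      rw [Finset.sum_eq_single n]
      · simp
      · intro b _ hb
        rw [pderiv_X_of_ne hb.symm]; simp
      · simp
    have hs : ∀ i, aeval ℓ (pderiv i (p * X n)) * Polynomial.derivative (ℓ i) =
        aeval ℓ (pderiv i p) * Polynomial.derivative (ℓ i) * ℓ n +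
        aeval ℓ p * (aeval ℓ (pderiv i (X n : MvPolynomial (Fin 3) ℂ)) *
          Polynomial.derivative (ℓ i)) := by
      intro i
      rw [pderiv_mul, map_add, map_mul, map_mul, aeval_X]; ring
    rw [Finset.sum_congr rfl fun i _ => hs i, Finset.sum_add_distrib, ← Finset.sum_mul,
      ← Finset.mul_sum, hX, ← hp, map_mul, aeval_X, Polynomial.derivative_mul]

lemma dvd_of_vanish (ℓ : Fin 3 → Polynomial ℂ) (t : ℂ) (m : ℕ) :
    ∀ (F : MvPolynomial (Fin 3) ℂ),
      vanishesToOrder2 F (fun i => (ℓ i).eval t) m →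
      (Polynomial.X - Polynomial.C t) ^ m ∣ aeval ℓ F := by
  induction m with
  | zero => intro F h; simp
  | succ m ih =>
    intro F h
    have h0 : (aeval ℓ F).eval t = 0 := by
      have := h [] (by simp)
      rw [List.foldl_nil] at this
      rw [← this, ← Polynomial.coe_aeval_eq_eval, ← AlgHom.coe_toRingHom]
      change (Polynomial.aeval t) (aeval ℓ F) = _
      rw [← MvPolynomial.coe_aeval_eq_eval]
      change ((Polynomial.aeval t).comp (aeval ℓ)) F = _
      rw [MvPolynomial.comp_aeval]
      rfl
    have h1 : (Polynomial.X - Polynomial.C t) ^ m ∣ Polynomial.derivative (aeval ℓ F) := by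
      rw [derivative_aeval]
      exact Finset.dvd_sum fun i _ => Dvd.dvd.mul_right (ih _ (vanish_pderiv h i)) _
    by_cases hg : aeval ℓ F = 0
    · simp [hg]
    have h2 : Polynomial.derivative (aeval ℓ F) ≠ 0 := by
      intro h2
      have := Polynomial.natDegree_eq_zero_of_derivative_eq_zero h2
      rw [Polynomial.natDegree_eq_zero] at this
      obtain ⟨c, hc⟩ := this
      rw [← hc] at h0 hg
      simp at h0 hg
      exact hg h0
    rw [← Polynomial.le_rootMultiplicity_iff h2,
      Polynomial.derivative_rootMultiplicity_of_root h0] at h1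
    rw [← Polynomial.le_rootMultiplicity_iff hg]
    have := (Polynomial.rootMultiplicity_pos hg).2 h0
    omega

lemma fin3_sum {i j k : Fin 3} (hij : i ≠ j) (hik : i ≠ k) (hjk : j ≠ k) (f : Fin 3 → ℕ) :
    ∑ v, f v = f i + f j + f k := by
  rw [Fin.sum_univ_three]
  fin_cases i <;> fin_cases j <;> fin_cases k <;> simp_all <;> ring

lemma fin3_prod {i j k : Fin 3} (hij : i ≠ j) (hik : i ≠ k) (hjk : j ≠ k)
    (f : Fin 3 → Polynomial ℂ) : ∏ v, f v = f i * f j * f k := by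
  have h : (Finset.univ : Finset (Fin 3)) = {i, j, k} := by
    revert i j k; decide
  rw [h, Finset.prod_insert (by simp [hij, hik]), Finset.prod_insert (by simp [hjk]),
    Finset.prod_singleton, mul_assoc]

/-- The restriction of coordinates: `x_i = 0`, `x_k = T`, the other is `1`. -/
noncomputable def restr (i k : Fin 3) : Fin 3 → Polynomial ℂ :=
  fun v => if v = i then 0 else if v = k then Polynomial.X else 1

lemma coeff_restr {i j k : Fin 3} (hij : i ≠ j) (hik : i ≠ k) (hjk : j ≠ k)
    {H : MvPolynomial (Fin 3) ℂ} {e : ℕ} (hH : H.IsHomogeneous e) (s : Fin 3 →₀ ℕ)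
    (hs : s i = 0) (hse : s i + s j + s k = e) :
    (aeval (restr i k) H).coeff (s k) = coeff s H := by
  have key : ∀ u : Fin 3 →₀ ℕ, (∏ v, restr i k v ^ u v) =
      (if u i = 0 then 1 else 0) * Polynomial.X ^ (u k) := by
    intro u
    have : ∏ v, restr i k v ^ u v =
      restr i k i ^ u i * restr i k j ^ u j * restr i k k ^ u k := by
      exact fin3_prod hij hik hjk _
    rw [this]
    simp [restr, hij.symm, hik.symm, hjk, zero_pow_eq]
  rw [aeval_def, eval₂_eq', Polynomial.finset_sum_coeff]
  rw [Finset.sum_eq_single s]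
  · rw [key]; simp [hs, ← Polynomial.C_eq_algebraMap, Polynomial.coeff_C_mul]
  · intro u hu hus
    rw [key]
    by_cases hu0 : u i = 0
    · have hk : s k ≠ u k := by
        intro hk
        apply hus
        have := hH (mem_support_iff.1 hu)
        rw [Finsupp.weight_apply, Finsupp.sum_fintype _ _ (by simp)] at this
        simp only [Pi.one_apply, smul_eq_mul, mul_one] at this
        rw [fin3_sum hij hik hjk] at this
        have hj : u j = s j := by omega
        ext v
        have : v = i ∨ v = j ∨ v = k := by
          fin_cases i <;> fin_cases j <;> fin_cases k <;> fin_cases v <;> simp_all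
        rcases this with rfl | rfl | rfl
        · rw [hu0, hs]
        · exact hj
        · exact hk.symm
      simp [hu0, ← Polynomial.C_eq_algebraMap, Polynomial.coeff_C_mul, Polynomial.coeff_X_pow, hk]
    · simp [hu0]
  · intro h
    rw [notMem_support_iff.1 h]; simp

lemma core {i j k : Fin 3} (hij : i ≠ j) (hik : i ≠ k) (hjk : j ≠ k)
    {H : MvPolynomial (Fin 3) ℂ} {e m n : ℕ} (hH : H.IsHomogeneous e)
    (hj : vanishesToOrder2 H (fun v => if v = i then 0 else if v = k then 0 else 1) m)
    (hk : vanishesToOrder2 H (fun v => if v = i then 0 else if v = j then 0 else 1) m)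
    (hp : vanishesToOrder2 H (fun v => if v = i then 0 else if v = k then 1 else 1) n)
    (hq : vanishesToOrder2 H (fun v => if v = i then 0 else if v = k then -1 else 1) n)
    (hb : e < 2 * m + 2 * n) (s : Fin 3 →₀ ℕ) (hs : s i = 0) : coeff s H = 0 := by
  have hev : ∀ (k : Fin 3) (t : ℂ), (fun v => (restr i k v).eval t) =
      (fun v => if v = i then 0 else if v = k then t else 1) := by
    intro k t; funext v; unfold restr; split_ifs <;> simp
  have d0 := dvd_of_vanish (restr i k) 0 m H (by rw [hev]; exact hj)
  have d1 := dvd_of_vanish (restr i k) 1 n H (by rw [hev]; exact hp)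
  have d2 := dvd_of_vanish (restr i k) (-1) n H (by rw [hev]; exact hq)
  have d3 := dvd_of_vanish (restr i j) 0 m H (by rw [hev]; exact hk)
  have hdeg : ∀ u : Fin 3 →₀ ℕ, u i + u j + u k ≠ e → coeff u H = 0 := by
    intro u hu
    apply hH.coeff_eq_zero
    rwa [Finsupp.degree_eq_sum, fin3_sum hij hik hjk]
  -- the monomial with exponents (0, e - c, c)
  by_cases hse : s i + s j + s k = e
  swap
  · exact hdeg s hse
  rw [← coeff_restr hij hik hjk hH s hs hse]
  suffices hz : aeval (restr i k) H = 0 by simp [hz]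
  by_contra hg
  have hdvd : (Polynomial.X - Polynomial.C 0) ^ m * (Polynomial.X - Polynomial.C 1) ^ n *
      (Polynomial.X - Polynomial.C (-1)) ^ n ∣ aeval (restr i k) H := by
    have cop : ∀ a b : ℂ, a ≠ b → IsCoprime (Polynomial.X - Polynomial.C a)
        (Polynomial.X - Polynomial.C b) := fun a b hab =>
      Polynomial.isCoprime_X_sub_C_of_isUnit_sub (sub_ne_zero.2 hab).isUnit
    refine IsCoprime.mul_dvd (IsCoprime.mul_left ?_ ?_) (IsCoprime.mul_dvd ?_ d0 d1) d2
    · exact (cop _ _ (by norm_num)).pow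
    · exact (cop _ _ (by norm_num)).pow
    · exact (cop _ _ (by norm_num)).pow
  have hle := Polynomial.natDegree_le_of_dvd hdvd hg
  rw [Polynomial.natDegree_mul, Polynomial.natDegree_mul, Polynomial.natDegree_pow,
    Polynomial.natDegree_pow, Polynomial.natDegree_pow, Polynomial.natDegree_X_sub_C,
    Polynomial.natDegree_X_sub_C, Polynomial.natDegree_X_sub_C] at hle
  rotate_left
  · exact pow_ne_zero _ (Polynomial.X_sub_C_ne_zero _)
  · exact pow_ne_zero _ (Polynomial.X_sub_C_ne_zero _)
  · exact mul_ne_zero (pow_ne_zero _ (Polynomial.X_sub_C_ne_zero _))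
      (pow_ne_zero _ (Polynomial.X_sub_C_ne_zero _))
  · exact pow_ne_zero _ (Polynomial.X_sub_C_ne_zero _)
  -- degree of the leading term
  set c := (aeval (restr i k) H).natDegree with hc
  have hlead : (aeval (restr i k) H).coeff c ≠ 0 := by
    rw [hc]; exact Polynomial.leadingCoeff_ne_zero.2 hg
  have hce : c ≤ e := by
    refine Polynomial.natDegree_le_iff_coeff_eq_zero.2 ?_ |>.trans le_rfl
    intro N hN
    rw [aeval_def, eval₂_eq', Polynomial.finset_sum_coeff]
    refine Finset.sum_eq_zero fun u hu => ?_
    have hu' : u i + u j + u k = e := by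
      by_contra h; exact mem_support_iff.1 hu (hdeg u h)
    rw [← Polynomial.C_eq_algebraMap, Polynomial.coeff_C_mul]
    have : (∏ v, restr i k v ^ u v).natDegree ≤ e := by
      refine (Polynomial.natDegree_prod_le _ _).trans ?_
      rw [fin3_sum hij hik hjk, ← hu']
      have hb : ∀ v, (restr i k v ^ u v).natDegree ≤ u v := by
        intro v
        refine Polynomial.natDegree_pow_le.trans ?_
        have : (restr i k v).natDegree ≤ 1 := by
          unfold restr; split_ifs <;> simp
        nlinarith
      have := hb i; have := hb j; have := hb k; omega
    rw [Polynomial.coeff_eq_zero_of_natDegree_lt (by omega), mul_zero]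
  let u : Fin 3 →₀ ℕ := Finsupp.single j (e - c) + Finsupp.single k c
  have ui : u i = 0 := by simp [u, Finsupp.single_apply, hij.symm, hik.symm]
  have uj : u j = e - c := by simp [u, Finsupp.single_apply, hjk.symm]
  have uk : u k = c := by simp [u, Finsupp.single_apply, hjk]
  have e1 := coeff_restr hij hik hjk hH u ui (by omega)
  have e2 := coeff_restr hik hij hjk.symm hH u ui (by omega)
  rw [uk] at e1
  rw [uj] at e2
  rw [Polynomial.C_0, sub_zero, Polynomial.X_pow_dvd_iff] at d3
  have := d3 (e - c) (by omega)
  exact hlead (by rw [e1, ← e2, this])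

lemma coeff_pderiv' (i : Fin 3) (F : MvPolynomial (Fin 3) ℂ) (s : Fin 3 →₀ ℕ) :
    coeff s (pderiv i F) = (s i + 1) * coeff (s + Finsupp.single i 1) F := by
  induction F using MvPolynomial.induction_on' with
  | monomial u a =>
    rw [pderiv_monomial, coeff_monomial, coeff_monomial]
    by_cases h : u = s + Finsupp.single i 1
    · subst h; simp; ring
    · rw [if_neg h]
      split_ifs with h2
      · by_cases hu : u i = 0
        · simp [hu]
        · exfalso; apply h
          rw [← h2, tsub_add_cancel_of_le]
          rw [Finsupp.single_le_iff]; omega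
      · simp
  | add p q hp hq => simp [hp, hq]; ring

lemma coeff_iter (i : Fin 3) (a : ℕ) : ∀ (F : MvPolynomial (Fin 3) ℂ) (s : Fin 3 →₀ ℕ),
    coeff s ((pderiv i)^[a] F) = 0 → coeff (s + Finsupp.single i a) F = 0 := by
  induction a with
  | zero => intro F s h; simpa using h
  | succ a ih =>
    intro F s h
    rw [Function.iterate_succ_apply] at h
    have := ih _ _ h
    rw [coeff_pderiv', mul_eq_zero] at this
    rcases this with h | h
    · exfalso; norm_cast at h
    · rw [Finsupp.single_add, ← add_assoc]; exact h

lemma main_aux {i j k : Fin 3} (hij : i ≠ j) (hik : i ≠ k) (hjk : j ≠ k) {p d : ℕ} (hp1 : 1 ≤ p)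
    {H : MvPolynomial (Fin 3) ℂ} (hH : H.IsHomogeneous d) (hd : d ≤ 36 * p - 5)
    (hj : vanishesToOrder2 H (fun v => if v = i then 0 else if v = k then 0 else 1) (18 * p))
    (hk : vanishesToOrder2 H (fun v => if v = i then 0 else if v = j then 0 else 1) (18 * p))
    (hp : vanishesToOrder2 H (fun v => if v = i then 0 else if v = k then 1 else 1) (12 * p - 2))
    (hq : vanishesToOrder2 H (fun v => if v = i then 0 else if v = k then -1 else 1) (12 * p - 2)) :
    (X i : MvPolynomial (Fin 3) ℂ) ^ (8 * p + 1) ∣ H := by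
  have hco : ∀ s : Fin 3 →₀ ℕ, s i ≤ 8 * p → coeff s H = 0 := by
    intro s hs
    have hz := core hij hik hjk (homog_iter i (s i) H d hH) (vanish_iter i _ (s i) _ _ hj)
      (vanish_iter i _ (s i) _ _ hk) (vanish_iter i _ (s i) _ _ hp)
      (vanish_iter i _ (s i) _ _ hq) (by omega) (s.erase i) (by simp)
    have := coeff_iter i (s i) H _ hz
    rwa [Finsupp.erase_add_single] at this
  rw [H.as_sum]
  refine Finset.dvd_sum fun s hs => ?_
  have h1 : 8 * p + 1 ≤ s i := by
    by_contra h
    exact mem_support_iff.1 hs (hco s (by omega))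
  rw [X_pow_eq_monomial]
  refine ⟨monomial (s - Finsupp.single i (8 * p + 1)) (coeff s H), ?_⟩
  rw [monomial_mul, one_mul, add_tsub_cancel_of_le]
  rwa [Finsupp.single_le_iff]

theorem coordinate_lines_multiplicity (p : ℕ) (hp : 1 ≤ p)
    (Γ : MvPolynomial (Fin 3) ℂ) (d : ℕ) (hΓ : Γ ≠ 0) (hhom : Γ.IsHomogeneous d)
    (hd : d ≤ 36 * p - 5)
    (hstar : ∀ i : Fin 6, vanishesToOrder2 Γ (starPts i) (12 * p - 2))
    (hcoord : ∀ i : Fin 3, vanishesToOrder2 Γ (coordPts i) (18 * p))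
    (hz : ∀ i : Fin 4, vanishesToOrder2 Γ (zPts i) (3 * p + 1)) :
    (X 0 : MvPolynomial (Fin 3) ℂ) ^ (8 * p + 1) ∣ Γ ∧
    (X 1 : MvPolynomial (Fin 3) ℂ) ^ (8 * p + 1) ∣ Γ ∧
    (X 2 : MvPolynomial (Fin 3) ℂ) ^ (8 * p + 1) ∣ Γ := by
  refine ⟨main_aux (i := 0) (j := 1) (k := 2) (by decide) (by decide) (by decide) hp hhom hd
      ?_ ?_ ?_ ?_,
    main_aux (i := 1) (j := 0) (k := 2) (by decide) (by decide) (by decide) hp hhom hd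
      ?_ ?_ ?_ ?_,
    main_aux (i := 2) (j := 0) (k := 1) (by decide) (by decide) (by decide) hp hhom hd
      ?_ ?_ ?_ ?_⟩
  · convert hcoord 1 using 1; funext v; fin_cases v <;> simp [coordPts]
  · convert hcoord 2 using 1; funext v; fin_cases v <;> simp [coordPts]
  · convert hstar 4 using 1; funext v; fin_cases v <;> simp [starPts]
  · convert hstar 5 using 1; funext v; fin_cases v <;> simp [starPts]
  · convert hcoord 0 using 1; funext v; fin_cases v <;> simp [coordPts]
  · convert hcoord 2 using 1; funext v; fin_cases v <;> simp [coordPts]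
  · convert hstar 2 using 1; funext v; fin_cases v <;> simp [starPts]
  · convert hstar 3 using 1; funext v; fin_cases v <;> simp [starPts]
  · convert hcoord 0 using 1; funext v; fin_cases v <;> simp [coordPts]
  · convert hcoord 1 using 1; funext v; fin_cases v <;> simp [coordPts]
  · convert hstar 0 using 1; funext v; fin_cases v <;> simp [starPts]
  · convert hstar 1 using 1; funext v; fin_cases v <;> simp [starPts]
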